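/- arXiv:1610.04985 — 4 statements merged into one kernel-verified Lean document; each statement's English description precedes it below -/
import Mathlib

section
/- Let H be a complex Hilbert space, let H₀ ⊆ H be a closed linear subspace, let L be a linear operator with values in H defined on a linear subspace D(L) ⊆ H, and assume L is a closed operator (its graph is closed in H × H). Then for every x ∈ H there exists ξ ∈ H₀ ∩ D(L) that minimizes the functional G(y) := ‖y − x‖² + ‖L y‖² over all y ∈ H₀ ∩ D(L). -/
open MeasureTheory

/-- Distance minimization over a closed subspace of a product of Hilbert spaces, where the
squared distance is the sum of the squared distances of the components. -/
theorem Submodule.exists_forall_norm_sq_add_norm_sq_le {𝕜 E F : Type*} [RCLike 𝕜]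
    [NormedAddCommGroup E] [InnerProductSpace 𝕜 E] [CompleteSpace E]
    [NormedAddCommGroup F] [InnerProductSpace 𝕜 F] [CompleteSpace F]
    (K : Submodule 𝕜 (E × F)) (hK : IsClosed (K : Set (E × F))) (u : E × F) :
    ∃ p ∈ K, ∀ q ∈ K,
      ‖p.1 - u.1‖ ^ 2 + ‖p.2 - u.2‖ ^ 2 ≤ ‖q.1 - u.1‖ ^ 2 + ‖q.2 - u.2‖ ^ 2 := by
  let e := WithLp.prodContinuousLinearEquiv 2 𝕜 E F
  let M : Submodule 𝕜 (WithLp 2 (E × F)) := K.comap (e : WithLp 2 (E × F) →ₗ[𝕜] E × F)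
  have hM : IsClosed (M : Set (WithLp 2 (E × F))) := hK.preimage e.continuous
  obtain ⟨v, hv, hmin⟩ :=
    M.exists_norm_eq_iInf_of_complete_subspace hM.isComplete (WithLp.toLp 2 u)
  refine ⟨WithLp.ofLp v, hv, fun q hq => ?_⟩
  have hle : ‖WithLp.toLp 2 u - v‖ ≤ ‖WithLp.toLp 2 u - WithLp.toLp 2 q‖ :=
    hmin.trans_le (ciInf_le (f := fun w : (M : Set (WithLp 2 (E × F))) =>
        ‖WithLp.toLp 2 u - (w : WithLp 2 (E × F))‖)
      ⟨0, by rintro _ ⟨w, rfl⟩; exact norm_nonneg _⟩ ⟨WithLp.toLp 2 q, hq⟩)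
  have hsq := pow_le_pow_left₀ (norm_nonneg _) hle 2
  rw [norm_sub_rev, norm_sub_rev (WithLp.toLp 2 u), WithLp.prod_norm_sq_eq_of_L2,
    WithLp.prod_norm_sq_eq_of_L2] at hsq
  exact hsq

/-- Existence of a minimizer for `G(y) = ‖y - x‖² + ‖L y‖²` over `H₀ ∩ D(L)`,
for a closed linear operator `L` and a closed subspace `H₀` of a complex Hilbert space. -/
theorem existence_of_minimizer
    {H : Type*} [NormedAddCommGroup H] [InnerProductSpace ℂ H] [CompleteSpace H]
    (H₀ : Submodule ℂ H) (hH₀ : IsClosed (H₀ : Set H))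
    (L : H →ₗ.[ℂ] H) (hL : L.IsClosed) (x : H) :
    ∃ (ξ : H) (hξ : ξ ∈ L.domain), ξ ∈ H₀ ∧
      ∀ (y : H) (hy : y ∈ L.domain), y ∈ H₀ →
        ‖ξ - x‖ ^ 2 + ‖L ⟨ξ, hξ⟩‖ ^ 2 ≤ ‖y - x‖ ^ 2 + ‖L ⟨y, hy⟩‖ ^ 2 := by
  obtain ⟨p, ⟨hpL, hp₀⟩, hmin⟩ :=
    (L.graph ⊓ H₀.comap (LinearMap.fst ℂ H H)).exists_forall_norm_sq_add_norm_sq_le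
      (hL.inter (hH₀.preimage continuous_fst)) (x, 0)
  obtain ⟨ξ, hξ, hLξ⟩ := L.mem_graph_iff.mp hpL
  have hdom : p.1 ∈ L.domain := hξ ▸ ξ.2
  have hval : L ⟨p.1, hdom⟩ = p.2 := by
    rw [← hLξ]
    exact congrArg L (Subtype.ext hξ.symm)
  refine ⟨p.1, hdom, hp₀, fun y hy hy₀ => ?_⟩
  have h := hmin (y, L ⟨y, hy⟩) ⟨L.mem_graph ⟨y, hy⟩, hy₀⟩
  simpa only [hval, sub_zero] using h
end

section
/- Let f ≥ 0 be a Lebesgue-integrable function on [−π, π) (a spectral density) and let ℓ : [−π, π) → ℂ be measurable. Let σ_int² := inf { ∫_{−π}^{π} (|ψ(u) − 1|² + |ℓ(u) ψ(u)|²) f(u) du : ψ ∈ 𝓛° }, where 𝓛° is the closed linear span, in L²(f(u)du), of the functions u ↦ e^{i s u} over integers s with |s| ≥ 1. If ∫_{−π}^{π} du / f(u) = ∞, then σ_int² = ∫_{−π}^{π} (|ℓ(u)|² / (1 + |ℓ(u)|²)) f(u) du. -/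
open MeasureTheory ENNReal Real

/-- An integrable function on `[-π, π)` all of whose Fourier coefficients vanish is zero a.e. -/
theorem ae_eq_zero_of_integral_exp_mul_eq_zero {g : ℝ → ℂ}
    (hg : IntegrableOn g (Set.Ico (-π) π))
    (h : ∀ n : ℤ, ∫ u in Set.Ico (-π) π, Complex.exp (Complex.I * n * u) * g u = 0) :
    ∀ᵐ u ∂(volume.restrict (Set.Ico (-π) π)), g u = 0 := by
  have : Fact (0 < 2 * π) := ⟨by positivity⟩
  have hint : ∀ φ : C(AddCircle (2 * π), ℂ),
      IntegrableOn (fun u : ℝ => φ (u : AddCircle (2 * π)) * g u) (Set.Ico (-π) π) := fun φ =>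
    hg.bdd_mul (c := ‖φ‖)
      (φ.continuous.comp (AddCircle.continuous_mk' (2 * π))).aestronglyMeasurable
      (ae_of_all _ fun u => φ.norm_coe_le_norm _)
  let Φ : C(AddCircle (2 * π), ℂ) →L[ℂ] ℂ := LinearMap.mkContinuous
    { toFun := fun φ => ∫ u in Set.Ico (-π) π, φ (u : AddCircle (2 * π)) * g u
      map_add' := fun φ ψ => by
        rw [← integral_add (hint φ) (hint ψ)]
        simp [add_mul]
      map_smul' := fun c φ => by
        simp [mul_assoc, integral_const_mul] }
    (∫ u in Set.Ico (-π) π, ‖g u‖) (fun φ => by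
      rw [mul_comm (∫ u in _, ‖g u‖) ‖φ‖, ← integral_const_mul]
      refine norm_integral_le_of_norm_le (hg.norm.const_mul _) (ae_of_all _ fun u => ?_)
      rw [norm_mul]
      gcongr
      exact φ.norm_coe_le_norm _)
  have hΦ : ∀ φ, Φ φ = ∫ u in Set.Ico (-π) π, φ (u : AddCircle (2 * π)) * g u := fun φ => rfl
  have hker : (⊤ : Submodule ℂ C(AddCircle (2 * π), ℂ)) ≤ LinearMap.ker Φ.toLinearMap := by
    rw [← span_fourier_closure_eq_top]
    refine Submodule.topologicalClosure_minimal _ (Submodule.span_le.2 ?_) Φ.isClosed_ker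
    rintro _ ⟨n, rfl⟩
    change Φ (fourier n) = 0
    rw [hΦ, ← h n]
    congr 1 with u
    rw [fourier_coe_apply]
    congr 2
    push_cast
    field_simp
  rw [Measure.restrict_congr_set Ioo_ae_eq_Ico.symm]
  have key := isOpen_Ioo.ae_eq_zero_of_integral_contDiff_smul_eq_zero (U := Set.Ioo (-π) π)
    (f := g) (μ := volume) (hg.mono_set Set.Ioo_subset_Ico_self).locallyIntegrableOn ?_
  · exact (ae_restrict_iff' measurableSet_Ioo).2 key
  intro φ hφ hφc hφs
  have hout : ∀ u, u ∉ Set.Ioo (-π) π → φ u = 0 := fun u hu =>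
    image_eq_zero_of_notMem_tsupport fun hu' => hu (hφs hu')
  have hper : -π + 2 * π = π := by ring
  have hcont : Continuous (AddCircle.liftIco (2 * π) (-π) fun u => (φ u : ℂ)) := by
    refine AddCircle.liftIco_continuous ?_
      (Complex.continuous_ofReal.comp hφ.continuous).continuousOn
    rw [hper, hout _ (by simp), hout _ (by simp)]
  have h0 : Φ ⟨_, hcont⟩ = 0 := hker (Submodule.mem_top)
  rw [hΦ] at h0
  rw [← setIntegral_eq_integral_of_forall_compl_eq_zero (s := Set.Ico (-π) π), ← h0]
  · refine setIntegral_congr_fun measurableSet_Ico fun u hu => ?_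
    simp only [ContinuousMap.coe_mk]
    rw [AddCircle.liftIco_coe_apply (by rwa [hper])]
    simp
  · intro u hu
    rw [hout u fun h' => hu (Set.Ioo_subset_Ico_self h'), zero_smul]

/-- If only the zeroth Fourier coefficient of an integrable function on `[-π, π)` may be nonzero,
the function is constant a.e. -/
theorem ae_eq_const_of_integral_exp_mul_eq_zero {g : ℝ → ℂ}
    (hg : IntegrableOn g (Set.Ico (-π) π))
    (h : ∀ n : ℤ, n ≠ 0 → ∫ u in Set.Ico (-π) π, Complex.exp (Complex.I * n * u) * g u = 0) :
    ∃ c : ℂ, ∀ᵐ u ∂(volume.restrict (Set.Ico (-π) π)), g u = c := by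
  set c : ℂ := (2 * π)⁻¹ * ∫ u in Set.Ico (-π) π, g u with hc
  have hcint : IntegrableOn (fun _ => c) (Set.Ico (-π) π) := by simp
  have hexp : ∀ n : ℤ, ∀ {k : ℝ → ℂ}, IntegrableOn k (Set.Ico (-π) π) →
      IntegrableOn (fun u : ℝ => Complex.exp (Complex.I * n * u) * k u) (Set.Ico (-π) π) :=
    fun n k hk => hk.bdd_mul (c := 1) (by fun_prop)
      (ae_of_all _ fun u => by simp [Complex.norm_exp])
  refine ⟨c, (ae_eq_zero_of_integral_exp_mul_eq_zero (hg.sub hcint) fun n => ?_).mono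
    fun u hu => sub_eq_zero.1 hu⟩
  simp only [Pi.sub_apply, mul_sub]
  rw [integral_sub (hexp n hg) (hexp n hcint), integral_mul_const, integral_Ico_eq_integral_Ioc,
    integral_Ico_eq_integral_Ioc,
    ← intervalIntegral.integral_of_le (f := fun u : ℝ => Complex.exp (Complex.I * n * u))
      (by linarith [pi_pos])]
  rw [← integral_Ico_eq_integral_Ioc]
  rcases eq_or_ne n 0 with rfl | hn
  · have : (π : ℂ) ≠ 0 := by exact_mod_cast pi_ne_zero
    simp [hc]
    field_simp
    ring
  · rw [h n hn, integral_exp_mul_complex (by simpa using hn)]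
    have : Complex.exp (Complex.I * n * (π : ℝ)) = Complex.exp (Complex.I * n * (-π : ℝ)) := by
      rw [Complex.exp_eq_exp_iff_exists_int]
      exact ⟨n, by push_cast; ring⟩
    rw [this]
    simp

/-- Completing the square in the interpolation functional. -/
theorem norm_sub_one_sq_add_norm_mul_sq (l z : ℂ) :
    ‖z - 1‖ ^ 2 + ‖l * z‖ ^ 2 =
      (1 + ‖l‖ ^ 2) * ‖z - ((1 + ‖l‖ ^ 2)⁻¹ : ℝ)‖ ^ 2 + ‖l‖ ^ 2 / (1 + ‖l‖ ^ 2) := by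
  have hq : 1 + ‖l‖ ^ 2 ≠ 0 := by positivity
  rw [norm_mul, mul_pow]
  generalize ‖l‖ ^ 2 = q at *
  simp only [Complex.sq_norm, Complex.normSq_apply, Complex.sub_re, Complex.sub_im,
    Complex.one_re, Complex.one_im, Complex.ofReal_re, Complex.ofReal_im]
  field_simp
  ring

/-- Kolmogorov's criterion: if `∫ du/f(u) = ∞`, the exponentials `e^{isu}`, `|s| ≥ 1`, span a dense
subspace of `L²(f(u) du)`. -/
theorem span_exp_topologicalClosure_eq_top_of_reciprocal_divergent
    {f : ℝ → ℝ} (hf_meas : Measurable f) (hf_nonneg : ∀ u, 0 ≤ f u)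
    (hf_int : IntegrableOn f (Set.Ico (-π) π) volume)
    {μ : Measure ℝ}
    (hμ : μ = (volume.restrict (Set.Ico (-π) π)).withDensity (fun u => ENNReal.ofReal (f u)))
    (hdiv : ∫⁻ u in Set.Ico (-π) π, (ENNReal.ofReal (f u))⁻¹ = ∞) :
    (Submodule.span ℂ
      {g : Lp ℂ 2 μ | ∃ s : ℤ, 1 ≤ |s| ∧
        (g : ℝ → ℂ) =ᵐ[μ] fun u : ℝ => Complex.exp (Complex.I * (s : ℂ) * (u : ℂ))}
      ).topologicalClosure = ⊤ := by
  have hofReal : Measurable fun u => ENNReal.ofReal (f u) := hf_meas.ennreal_ofReal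
  subst hμ
  set μ := (volume.restrict (Set.Ico (-π) π)).withDensity (fun u => ENNReal.ofReal (f u))
  have : IsFiniteMeasure μ := isFiniteMeasure_withDensity_ofReal hf_int.2
  rw [Submodule.topologicalClosure_eq_top_iff, Submodule.eq_bot_iff]
  intro h hh
  have hh2 : MemLp h 2 μ := Lp.memLp h
  have hh1 : Integrable h μ := hh2.integrable (by norm_num)
  have htoReal : ∀ (k : ℝ → ℂ) (u : ℝ), (ENNReal.ofReal (f u)).toReal • k u = f u * k u :=
    fun k u => by rw [ENNReal.toReal_ofReal (hf_nonneg u), Complex.real_smul]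
  have hlt : ∀ᵐ u ∂(volume.restrict (Set.Ico (-π) π)), ENNReal.ofReal (f u) < ∞ :=
    ae_of_all _ fun u => ENNReal.ofReal_lt_top
  have hgint : IntegrableOn (fun u => f u * h u) (Set.Ico (-π) π) := by
    have := (integrable_withDensity_iff_integrable_smul' hofReal hlt).1 hh1
    simp only [htoReal] at this
    exact this
  have hcoef : ∀ n : ℤ, n ≠ 0 →
      ∫ u in Set.Ico (-π) π, Complex.exp (Complex.I * n * u) * (f u * h u) = 0 := by
    intro n hn
    have hmem : MemLp (fun u : ℝ => Complex.exp (Complex.I * ((-n : ℤ) : ℂ) * u)) 2 μ :=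
      MemLp.of_bound (by fun_prop) 1 (ae_of_all _ fun u => by simp [Complex.norm_exp])
    have hin := (Submodule.mem_orthogonal _ _).1 hh (hmem.toLp _)
      (Submodule.subset_span ⟨-n, by rw [abs_neg]; exact Int.one_le_abs hn, hmem.coeFn_toLp⟩)
    rw [L2.inner_def] at hin
    rw [← hin, integral_congr_ae (μ := μ)
      (g := fun u : ℝ => Complex.exp (Complex.I * n * u) * h u)
      (hmem.coeFn_toLp.mono fun u hu => ?_)]
    · rw [integral_withDensity_eq_integral_toReal_smul hofReal hlt]
      congr 1 with u
      rw [htoReal (fun u : ℝ => Complex.exp (Complex.I * n * u) * h u)]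
      ring
    · simp only
      rw [hu, RCLike.inner_apply, ← Complex.exp_conj, mul_comm]
      simp
  obtain ⟨c, hc⟩ := ae_eq_const_of_integral_exp_mul_eq_zero hgint hcoef
  have hc0 : c = 0 := by
    by_contra hne
    have hfin : ∫⁻ u, ‖h u‖ₑ ^ 2 ∂μ < ∞ := by
      have := hh2.eLpNorm_lt_top
      rw [eLpNorm_lt_top_iff_lintegral_rpow_enorm_lt_top (by norm_num) (by norm_num)] at this
      simpa using this
    have hsq : ∀ᵐ u ∂(volume.restrict (Set.Ico (-π) π)),
        ENNReal.ofReal (f u) * ‖h u‖ₑ ^ 2 = ‖c‖ₑ ^ 2 * (ENNReal.ofReal (f u))⁻¹ := by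
      filter_upwards [hc] with u hu
      have hfu : f u ≠ 0 := by
        intro h0
        exact hne (by rw [← hu, h0]; simp)
      have hpos : ENNReal.ofReal (f u) ≠ 0 := by
        simpa using lt_of_le_of_ne (hf_nonneg u) hfu.symm
      rw [← hu, enorm_mul, ← ofReal_norm (f u : ℂ), Complex.norm_real,
        Real.norm_of_nonneg (hf_nonneg u), mul_pow, sq (ENNReal.ofReal _), mul_right_comm,
        mul_assoc (ENNReal.ofReal _), ENNReal.mul_inv_cancel hpos ENNReal.ofReal_ne_top, mul_one]
    rw [lintegral_withDensity_eq_lintegral_mul₀' hofReal.aemeasurable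
      (hh1.1.enorm.pow_const 2)] at hfin
    simp only [Pi.mul_apply] at hfin
    rw [lintegral_congr_ae hsq, lintegral_const_mul' _ _ (by simp), hdiv,
      ENNReal.mul_top (by simpa using hne)] at hfin
    exact lt_irrefl _ hfin
  rw [Lp.eq_zero_iff_ae_eq_zero]
  refine (ae_withDensity_iff hofReal).2 ?_
  filter_upwards [hc] with u hu hpos
  rw [hc0, mul_eq_zero, Complex.ofReal_eq_zero] at hu
  exact hu.resolve_left fun h0 => hpos (by simp [h0])

/-- Extended interpolation problem, singular case: for a spectral density `f` on `[-π,π)` with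
`∫ du/f(u) = ∞`, the interpolation error over the closed span `𝓛₁` of the exponentials
`e^{isu}`, `|s| ≥ 1`, equals `∫ (|ℓ|²/(1+|ℓ|²)) f du`. -/
theorem interpolation_error_of_reciprocal_divergent
    (f : ℝ → ℝ) (hf_meas : Measurable f) (hf_nonneg : ∀ u, 0 ≤ f u)
    (hf_int : IntegrableOn f (Set.Ico (-π) π) volume)
    (μ : Measure ℝ)
    (hμ : μ = (volume.restrict (Set.Ico (-π) π)).withDensity (fun u => ENNReal.ofReal (f u)))
    (ℓ : ℝ → ℂ) (hℓ : Measurable ℓ)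
    (𝓛₁ : Set (Lp ℂ 2 μ))
    (h𝓛₁ : 𝓛₁ = closure (Submodule.span ℂ
      {g : Lp ℂ 2 μ | ∃ s : ℤ, 1 ≤ |s| ∧
        (g : ℝ → ℂ) =ᵐ[μ] fun u : ℝ => Complex.exp (Complex.I * (s : ℂ) * (u : ℂ))}))
    (J : Lp ℂ 2 μ → ℝ≥0∞)
    (hJ : ∀ ψ : Lp ℂ 2 μ, J ψ =
      (∫⁻ u, (‖(ψ : ℝ → ℂ) u - 1‖₊ : ℝ≥0∞) ^ 2 ∂μ) +
        ∫⁻ u, (‖ℓ u * (ψ : ℝ → ℂ) u‖₊ : ℝ≥0∞) ^ 2 ∂μ)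
    (σsqInt : ℝ≥0∞) (hσsqInt : σsqInt = sInf (J '' 𝓛₁))
    (hdiv : ∫⁻ u in Set.Ico (-π) π, (ENNReal.ofReal (f u))⁻¹ = ∞) :
    σsqInt = ∫⁻ u in Set.Ico (-π) π,
      ENNReal.ofReal (‖ℓ u‖ ^ 2 / (1 + ‖ℓ u‖ ^ 2) * f u) := by
  have htop : 𝓛₁ = Set.univ := by
    rw [h𝓛₁, ← Submodule.topologicalClosure_coe,
      span_exp_topologicalClosure_eq_top_of_reciprocal_divergent hf_meas hf_nonneg hf_int hμ hdiv,
      Submodule.top_coe]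
  have : IsFiniteMeasure μ := by
    rw [hμ]
    exact isFiniteMeasure_withDensity_ofReal hf_int.2
  have hJ' : ∀ ψ : Lp ℂ 2 μ, J ψ =
      ∫⁻ u, ENNReal.ofReal ((1 + ‖ℓ u‖ ^ 2) * ‖ψ u - ((1 + ‖ℓ u‖ ^ 2)⁻¹ : ℝ)‖ ^ 2
        + ‖ℓ u‖ ^ 2 / (1 + ‖ℓ u‖ ^ 2)) ∂μ := by
    intro ψ
    have hψ : AEMeasurable (ψ : ℝ → ℂ) μ := (Lp.aestronglyMeasurable ψ).aemeasurable
    rw [hJ, ← lintegral_add_left' (by fun_prop)]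
    refine lintegral_congr fun u => ?_
    rw [← norm_sub_one_sq_add_norm_mul_sq, ENNReal.ofReal_add (by positivity) (by positivity),
      ENNReal.ofReal_pow (norm_nonneg _), ENNReal.ofReal_pow (norm_nonneg _), ofReal_norm,
      ofReal_norm]
    rfl
  have hRHS : ∫⁻ u in Set.Ico (-π) π, ENNReal.ofReal (‖ℓ u‖ ^ 2 / (1 + ‖ℓ u‖ ^ 2) * f u) =
      ∫⁻ u, ENNReal.ofReal (‖ℓ u‖ ^ 2 / (1 + ‖ℓ u‖ ^ 2)) ∂μ := by
    rw [hμ, lintegral_withDensity_eq_lintegral_mul _ hf_meas.ennreal_ofReal (by fun_prop)]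
    refine lintegral_congr fun u => ?_
    rw [mul_comm, ENNReal.ofReal_mul (hf_nonneg u), Pi.mul_apply]
  rw [hσsqInt, htop, Set.image_univ, hRHS]
  refine le_antisymm ?_ (le_sInf ?_)
  · have hmem : MemLp (fun u => (((1 + ‖ℓ u‖ ^ 2)⁻¹ : ℝ) : ℂ)) 2 μ := by
      refine MemLp.of_bound (Measurable.aestronglyMeasurable (by fun_prop)) 1
        (ae_of_all _ fun u => ?_)
      rw [Complex.norm_real, Real.norm_of_nonneg (by positivity)]
      exact inv_le_one_of_one_le₀ (by nlinarith [sq_nonneg ‖ℓ u‖])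
    refine (sInf_le (Set.mem_range_self (hmem.toLp _))).trans_eq ?_
    rw [hJ']
    refine lintegral_congr_ae (hmem.coeFn_toLp.mono fun u hu => ?_)
    simp only
    rw [hu]
    simp
  · rintro _ ⟨ψ, rfl⟩
    rw [hJ']
    exact lintegral_mono fun u => ENNReal.ofReal_le_ofReal
      (le_add_of_nonneg_left (by positivity))
end

section
/- Let α > 0. Then ∫_{−∞}^{∞} ( α² u² / (α² u² + 1) ) · ( 2 / (π (4u² + 1)) ) du = α / (2 + α). That is, the error of optimal non-adaptive energy-saving approximation of the Ornstein–Uhlenbeck process equals σ² = α/(2+α). -/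
open Real

theorem integrable_inv_sq_mul_sq_add_one {a : ℝ} (ha : a ≠ 0) :
    MeasureTheory.Integrable fun u : ℝ => (a ^ 2 * u ^ 2 + 1)⁻¹ := by
  have h := integrable_inv_one_add_sq.comp_mul_left' ha
  simpa only [mul_pow, add_comm] using h

theorem integral_inv_sq_mul_sq_add_one {a : ℝ} (ha : 0 < a) :
    ∫ u : ℝ, (a ^ 2 * u ^ 2 + 1)⁻¹ = π / a := by
  have h := MeasureTheory.Measure.integral_comp_mul_left (fun u : ℝ => (1 + u ^ 2)⁻¹) a
  rw [integral_univ_inv_one_add_sq, abs_of_pos (inv_pos.mpr ha), smul_eq_mul] at h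
  simp only [mul_pow, add_comm (1 : ℝ)] at h
  rw [h]
  field_simp

theorem tendsto_div_four_mul_sq_add_one {l : Filter ℝ}
    (hl : Filter.Tendsto (fun u : ℝ => u⁻¹) l (nhds 0)) :
    Filter.Tendsto (fun u : ℝ => u / (4 * u ^ 2 + 1)) l (nhds 0) := by
  refine squeeze_zero_norm (fun u => ?_) (by simpa using hl.norm)
  rcases eq_or_ne u 0 with rfl | hu
  · simp
  · have hu' : 0 < |u| := abs_pos.mpr hu
    have h4 : 0 < 4 * u ^ 2 + 1 := by positivity
    rw [Real.norm_eq_abs, abs_div, abs_of_pos h4,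
      div_le_iff₀ h4, inv_mul_eq_div, le_div_iff₀ hu', abs_mul_abs_self]
    nlinarith [sq_nonneg u]

theorem integral_four_mul_sq_div_sq :
    ∫ u : ℝ, 4 * u ^ 2 / (4 * u ^ 2 + 1) ^ 2 = π / 4 := by
  have hderiv (u : ℝ) : HasDerivAt
      (fun u : ℝ => arctan (2 * u) / 4 - u / (4 * u ^ 2 + 1) / 2)
      (4 * u ^ 2 / (4 * u ^ 2 + 1) ^ 2) u := by
    have h4 : 4 * u ^ 2 + 1 ≠ 0 := by positivity
    have h1 := (((hasDerivAt_id u).const_mul 2).arctan).div_const 4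
    have h2 := ((hasDerivAt_id u).div
      ((((hasDerivAt_id u).pow 2).const_mul 4).add_const 1) h4).div_const 2
    refine (h1.sub h2).congr_deriv ?_
    simp only [Pi.pow_apply, id]
    rw [show 1 + (2 * u) ^ 2 = 4 * u ^ 2 + 1 by ring]
    field_simp
    norm_num
    ring
  have hint : MeasureTheory.Integrable fun u : ℝ => 4 * u ^ 2 / (4 * u ^ 2 + 1) ^ 2 := by
    refine (integrable_inv_sq_mul_sq_add_one (two_ne_zero (α := ℝ))).mono'
      (Measurable.aestronglyMeasurable (by fun_prop)) (.of_forall fun u => ?_)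
    have h4 : 0 < 4 * u ^ 2 + 1 := by positivity
    rw [Real.norm_of_nonneg (by positivity), show (2 : ℝ) ^ 2 = 4 by norm_num, inv_eq_one_div,
      div_le_div_iff₀ (by positivity) h4]
    nlinarith
  have htop : Filter.Tendsto (fun u : ℝ => arctan (2 * u) / 4 - u / (4 * u ^ 2 + 1) / 2)
      Filter.atTop (nhds (π / 2 / 4 - 0 / 2)) :=
    (((tendsto_arctan_atTop.mono_right nhdsWithin_le_nhds).comp
      (Filter.tendsto_id.const_mul_atTop two_pos)).div_const 4).sub
      ((tendsto_div_four_mul_sq_add_one tendsto_inv_atTop_zero).div_const 2)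
  have hbot : Filter.Tendsto (fun u : ℝ => arctan (2 * u) / 4 - u / (4 * u ^ 2 + 1) / 2)
      Filter.atBot (nhds (-(π / 2) / 4 - 0 / 2)) :=
    (((tendsto_arctan_atBot.mono_right nhdsWithin_le_nhds).comp
      (Filter.tendsto_id.const_mul_atBot two_pos)).div_const 4).sub
      ((tendsto_div_four_mul_sq_add_one tendsto_inv_atBot_zero).div_const 2)
  rw [MeasureTheory.integral_of_hasDerivAt_of_tendsto hderiv hint hbot htop]
  ring

/-- Error of optimal non-adaptive energy-saving approximation of the Ornstein–Uhlenbeck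
process: `∫_ℝ (α²u²/(α²u²+1)) · (2/(π(4u²+1))) du = α/(2+α)`. -/
theorem ornstein_uhlenbeck_nonadaptive_error (α : ℝ) (hα : 0 < α) :
    ∫ u : ℝ, (α ^ 2 * u ^ 2 / (α ^ 2 * u ^ 2 + 1)) * (2 / (π * (4 * u ^ 2 + 1))) =
      α / (2 + α) := by
  have hπ := pi_ne_zero
  rcases eq_or_ne α 2 with rfl | h2
  · have h (u : ℝ) : (2 ^ 2 * u ^ 2 / (2 ^ 2 * u ^ 2 + 1)) * (2 / (π * (4 * u ^ 2 + 1))) =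
        2 / π * (4 * u ^ 2 / (4 * u ^ 2 + 1) ^ 2) := by
      rw [show (2 : ℝ) ^ 2 = 4 by norm_num]
      have h4 : 4 * u ^ 2 + 1 ≠ 0 := by positivity
      field_simp
    simp_rw [h]
    rw [MeasureTheory.integral_const_mul, integral_four_mul_sq_div_sq]
    field_simp
    norm_num
  · have hsub : α - 2 ≠ 0 := sub_ne_zero.mpr h2
    have hadd : 2 + α ≠ 0 := by positivity
    have h (u : ℝ) : (α ^ 2 * u ^ 2 / (α ^ 2 * u ^ 2 + 1)) * (2 / (π * (4 * u ^ 2 + 1))) =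
        2 / π * (α ^ 2 / ((α - 2) * (2 + α))) *
          ((2 ^ 2 * u ^ 2 + 1)⁻¹ - (α ^ 2 * u ^ 2 + 1)⁻¹) := by
      rw [show (2 : ℝ) ^ 2 = 4 by norm_num]
      have h4 : 4 * u ^ 2 + 1 ≠ 0 := by positivity
      have hα4 : α ^ 2 * u ^ 2 + 1 ≠ 0 := by positivity
      field_simp
      ring
    simp_rw [h]
    rw [MeasureTheory.integral_const_mul,
      MeasureTheory.integral_sub (integrable_inv_sq_mul_sq_add_one two_ne_zero)
        (integrable_inv_sq_mul_sq_add_one hα.ne'),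
      integral_inv_sq_mul_sq_add_one two_pos, integral_inv_sq_mul_sq_add_one hα]
    field_simp
end

section
/- Let 0 < H < 1 and α > 0, and set M_H := Γ(2H+1) sin(πH) / (2π). Then ∫_{−∞}^{∞} ( α² u² / (α² u² + 1) ) · ( M_H / |u|^{2H+1} ) du = M_H α^{2H} · π / sin(πH) = Γ(2H+1) α^{2H} / 2. In particular, for H = 1/2 and spectral measure μ(du) = V du/(2π u²) of a centered finite-variance Lévy process with Var B(1) = V, the corresponding error is σ² = α V / 2. -/
open Real

open MeasureTheory Set in
theorem integral_Ioo_rpow_mul_one_sub_rpow {s : ℝ} (h0 : 0 < s) (h1 : s < 1) :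
    ∫ x in Ioo (0 : ℝ) 1, x ^ (s - 1) * (1 - x) ^ (-s) = π / sin (π * s) := by
  rw [← Real.Gamma_mul_Gamma_one_sub, ← integral_Ioc_eq_integral_Ioo,
    ← intervalIntegral.integral_of_le zero_le_one]
  have hbeta := Complex.Gamma_mul_Gamma_eq_betaIntegral (s := (s : ℂ)) (t := ((1 - s : ℝ) : ℂ))
    (by simpa using h0) (by simpa using h1)
  rw [Complex.Gamma_ofReal, Complex.Gamma_ofReal, ← Complex.ofReal_add, add_sub_cancel,
    Complex.ofReal_one, Complex.Gamma_one, one_mul, Complex.betaIntegral] at hbeta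
  rw [← Complex.ofReal_inj, Complex.ofReal_mul, hbeta, ← intervalIntegral.integral_ofReal]
  refine intervalIntegral.integral_congr fun x hx ↦ ?_
  rw [uIcc_of_le zero_le_one] at hx
  rw [Complex.ofReal_mul, Complex.ofReal_cpow hx.1, Complex.ofReal_cpow (sub_nonneg.2 hx.2)]
  push_cast
  congr 2
  ring

open MeasureTheory Set in
theorem integral_Ioi_rpow_div_one_add {s : ℝ} (h0 : 0 < s) (h1 : s < 1) :
    ∫ t in Ioi (0 : ℝ), t ^ (s - 1) / (1 + t) = π / sin (π * s) := by
  rw [← integral_Ioo_rpow_mul_one_sub_rpow h0 h1]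
  have himage : (fun t : ℝ ↦ t / (1 + t)) '' Ioi 0 = Ioo 0 1 := by
    ext x
    constructor
    · rintro ⟨t, ht, rfl⟩
      have ht : 0 < t := ht
      exact ⟨by positivity, (div_lt_one (by positivity)).2 (by linarith)⟩
    · rintro ⟨hx0, hx1⟩
      have hx : 0 < 1 - x := sub_pos.2 hx1
      refine ⟨x / (1 - x), div_pos hx0 hx, ?_⟩
      field_simp
      simp
  have hderiv : ∀ t ∈ Ioi (0 : ℝ),
      HasDerivWithinAt (fun t : ℝ ↦ t / (1 + t)) (1 / (1 + t) ^ 2) (Ioi 0) t := by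
    intro t ht
    have ht : 0 < t := ht
    have h := (hasDerivAt_id t).div ((hasDerivAt_id t).const_add 1) (by simp; positivity)
    convert! h.hasDerivWithinAt using 1
    simp
  have hinj : InjOn (fun t : ℝ ↦ t / (1 + t)) (Ioi 0) := by
    intro a ha b hb hab
    have ha : 0 < a := ha
    have hb : 0 < b := hb
    have hab : a / (1 + a) = b / (1 + b) := hab
    rw [div_eq_div_iff (by positivity) (by positivity)] at hab
    linarith
  rw [← himage, integral_image_eq_integral_abs_deriv_smul measurableSet_Ioi hderiv hinj]
  refine setIntegral_congr_fun measurableSet_Ioi fun t ht ↦ ?_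
  have ht : 0 < t := ht
  have h1t : 0 < 1 + t := by positivity
  have hsub : 1 - t / (1 + t) = (1 + t)⁻¹ := by field_simp; ring
  simp only [smul_eq_mul]
  rw [hsub, abs_of_pos (by positivity), div_rpow ht.le h1t.le, inv_rpow h1t.le,
    rpow_neg h1t.le, inv_inv, rpow_sub_one h1t.ne']
  have := rpow_pos_of_pos h1t s
  field_simp

open MeasureTheory Set in
theorem integral_Ioi_rpow_div_sq_add_one {H : ℝ} (hH0 : 0 < H) (hH1 : H < 1) :
    ∫ v in Ioi (0 : ℝ), v ^ (1 - 2 * H) / (v ^ 2 + 1) = π / (2 * sin (π * H)) := by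
  have h := integral_Ioi_rpow_div_one_add (sub_pos.2 hH1) (sub_lt_self 1 hH0)
  rw [← integral_comp_rpow_Ioi_of_pos two_pos, mul_sub, mul_one, sin_pi_sub] at h
  have hcongr : ∀ v ∈ Ioi (0 : ℝ),
      (2 * v ^ ((2 : ℝ) - 1)) • ((v ^ (2 : ℝ)) ^ (1 - H - 1) / (1 + v ^ (2 : ℝ))) =
        2 * (v ^ (1 - 2 * H) / (v ^ 2 + 1)) := by
    intro v hv
    have hv : 0 < v := hv
    rw [smul_eq_mul, ← rpow_mul hv.le, mul_assoc, mul_div_assoc', ← rpow_add hv, rpow_two,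
      add_comm 1 (v ^ 2)]
    congr 3
    ring
  rw [setIntegral_congr_fun measurableSet_Ioi hcongr, integral_const_mul] at h
  rw [mul_comm 2 (sin _), ← div_div, ← h]
  ring

open MeasureTheory Set in
theorem integral_sq_div_sq_add_one_mul_div_abs_rpow {H α : ℝ} (hH0 : 0 < H) (hH1 : H < 1)
    (hα : 0 < α) (M : ℝ) :
    ∫ u : ℝ, (α ^ 2 * u ^ 2 / (α ^ 2 * u ^ 2 + 1)) * (M / |u| ^ (2 * H + 1)) =
      M * α ^ (2 * H) * π / sin (π * H) := by
  have habs := integral_comp_abs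
    (f := fun u ↦ (α ^ 2 * u ^ 2 / (α ^ 2 * u ^ 2 + 1)) * (M / u ^ (2 * H + 1)))
  simp only [sq_abs] at habs
  have hcongr : ∀ u ∈ Ioi (0 : ℝ),
      (α ^ 2 * u ^ 2 / (α ^ 2 * u ^ 2 + 1)) * (M / u ^ (2 * H + 1)) =
        M * α ^ (2 * H + 1) * ((α * u) ^ (1 - 2 * H) / ((α * u) ^ 2 + 1)) := by
    intro u hu
    have hu : 0 < u := hu
    have hexp : 1 - 2 * H = 2 - (2 * H + 1) := by ring
    rw [hexp, rpow_sub (mul_pos hα hu), mul_rpow hα.le hu.le (z := 2 * H + 1), rpow_two, mul_pow]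
    have := rpow_pos_of_pos hα (2 * H + 1)
    have := rpow_pos_of_pos hu (2 * H + 1)
    field_simp
  rw [habs, setIntegral_congr_fun measurableSet_Ioi hcongr, integral_const_mul,
    integral_comp_mul_left_Ioi (fun v ↦ v ^ (1 - 2 * H) / (v ^ 2 + 1)) 0 hα, mul_zero,
    integral_Ioi_rpow_div_sq_add_one hH0 hH1, rpow_add_one hα.ne', smul_eq_mul]
  field_simp

/-- Error of optimal non-adaptive energy-saving approximation of fractional Brownian motion
with Hurst parameter `H`: `∫_ℝ (α²u²/(α²u²+1)) · M_H/|u|^{2H+1} du = M_H α^{2H} π/sin(πH)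
= Γ(2H+1) α^{2H}/2`, where `M_H = Γ(2H+1) sin(πH)/(2π)`.  In particular, for `H = 1/2`
(a centered Lévy process with `Var B(1) = V`) the error is `αV/2`. -/
theorem fbm_nonadaptive_error
    (H : ℝ) (hH0 : 0 < H) (hH1 : H < 1) (α : ℝ) (hα : 0 < α) (M_H : ℝ)
    (hM : M_H = Real.Gamma (2 * H + 1) * Real.sin (π * H) / (2 * π)) :
    (∫ u : ℝ, (α ^ 2 * u ^ 2 / (α ^ 2 * u ^ 2 + 1)) * (M_H / |u| ^ (2 * H + 1)) =
      M_H * α ^ (2 * H) * π / Real.sin (π * H)) ∧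
    (∫ u : ℝ, (α ^ 2 * u ^ 2 / (α ^ 2 * u ^ 2 + 1)) * (M_H / |u| ^ (2 * H + 1)) =
      Real.Gamma (2 * H + 1) * α ^ (2 * H) / 2) ∧
    ∀ V : ℝ, 0 < V →
      ∫ u : ℝ, (α ^ 2 * u ^ 2 / (α ^ 2 * u ^ 2 + 1)) * (V / (2 * π * u ^ 2)) =
        α * V / 2 := by
  have hsin : 0 < sin (π * H) :=
    sin_pos_of_pos_of_lt_pi (by positivity) (mul_lt_of_lt_one_right pi_pos hH1)
  have herror := integral_sq_div_sq_add_one_mul_div_abs_rpow hH0 hH1 hα M_H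
  refine ⟨herror, ?_, fun V _ ↦ ?_⟩
  · rw [herror, hM, div_eq_iff hsin.ne']
    field_simp
  · have hhalf := integral_sq_div_sq_add_one_mul_div_abs_rpow (H := 1 / 2) (by norm_num)
      (by norm_num) hα (V / (2 * π))
    have hexp : (2 * (1 / 2) + 1 : ℝ) = 2 := by norm_num
    simp only [hexp, rpow_two, sq_abs, div_div] at hhalf
    rw [hhalf, mul_one_div_cancel two_ne_zero, rpow_one, mul_one_div, sin_pi_div_two]
    field_simp
end
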